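/- Let q = 2^m with m ≥ 2 and c ∈ 𝔽_q^*. Define f : 𝔽_{q²} → 𝔽₂ by f(x) = 0 if x^q + x = c^{2^{m−1}−1}, and f(x) = Tr₁^m(c x^{q+1}) otherwise. Then f is a bent function on 𝔽_{q²}. -/

import Mathlib

open scoped Classical

/-- The absolute trace of a field of characteristic 2, as the sum of Frobenius powers. -/
def FTr (F : Type*) [Field F] (k : ℕ) (x : F) : F :=
  ∑ i ∈ Finset.range k, x ^ 2 ^ i

/-- The additive character sign (-1)^y for y in the prime field {0,1}. -/
noncomputable def chi (F : Type*) [Field F] (y : F) : ℤ :=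
  if y = 0 then 1 else -1

section CharTwo

variable {F : Type*} [Field F] [CharP F 2]

theorem add_pow_two_pow (k : ℕ) (x y : F) : (x + y) ^ 2 ^ k = x ^ 2 ^ k + y ^ 2 ^ k :=
  add_pow_char_pow x y 2 k

theorem FTr_add (k : ℕ) (x y : F) : FTr F k (x + y) = FTr F k x + FTr F k y := by
  simp only [FTr, add_pow_two_pow, Finset.sum_add_distrib]

theorem FTr_sq_add_self (k : ℕ) (x : F) : FTr F k (x ^ 2 + x) = x ^ 2 ^ k + x := by
  induction k with
  | zero => simp [FTr, CharTwo.add_self_eq_zero]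
  | succ k ih =>
    rw [FTr, Finset.sum_range_succ, ← FTr, ih, add_pow_two_pow, ← pow_mul, ← pow_succ']
    linear_combination CharTwo.add_self_eq_zero (x ^ 2 ^ k)

theorem FTr_sq (k : ℕ) (x : F) : FTr F k (x ^ 2) = FTr F k x ^ 2 := by
  rw [FTr, FTr, sum_pow_char]
  exact Finset.sum_congr rfl fun i _ => pow_right_comm x 2 _

theorem FTr_sq_eq {k : ℕ} {x : F} (hx : x ^ 2 ^ k = x) : FTr F k (x ^ 2) = FTr F k x := by
  have h := FTr_sq_add_self k x
  rw [FTr_add, hx, CharTwo.add_self_eq_zero] at h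
  exact CharTwo.add_eq_zero.mp h

theorem FTr_eq_zero_or_one {k : ℕ} {x : F} (hx : x ^ 2 ^ k = x) :
    FTr F k x = 0 ∨ FTr F k x = 1 := by
  have h := FTr_sq k x
  rw [FTr_sq_eq hx] at h
  have h2 : FTr F k x * (FTr F k x - 1) = 0 := by linear_combination -h
  rcases mul_eq_zero.mp h2 with h | h
  · exact Or.inl h
  · exact Or.inr (sub_eq_zero.mp h)

theorem FTr_two_mul (k : ℕ) (x : F) : FTr F (2 * k) x = FTr F k (x ^ 2 ^ k + x) := by
  rw [FTr_add, FTr, two_mul, Finset.sum_range_add, add_comm]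
  simp only [FTr, pow_add, pow_mul]

theorem FTr_norm_eq_one {c ξ : F} {m : ℕ} (hξq : ξ ^ 2 ^ m = ξ) (hcξ : c * ξ ^ 2 = 1) {x : F}
    (hx : x ^ 2 ^ m + x = ξ) : FTr F m (c * x ^ (2 ^ m + 1)) = 1 := by
  have hξ : ξ ≠ 0 := by rintro rfl; simp at hcξ
  have h : c * x ^ (2 ^ m + 1) = (x / ξ) ^ 2 + x / ξ := by
    have hN : x ^ (2 ^ m + 1) = ξ * x + x ^ 2 := by
      rw [pow_succ]
      linear_combination x * hx - CharTwo.add_self_eq_zero (x ^ 2)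
    rw [hN]
    field_simp
    linear_combination (x * ξ + x ^ 2) * hcξ
  rw [h, FTr_sq_add_self, div_pow, hξq, ← add_div, hx, div_self hξ]

theorem chi_add {x y : F} (hx : x = 0 ∨ x = 1) (hy : y = 0 ∨ y = 1) :
    chi F (x + y) = chi F x * chi F y := by
  rcases hx with rfl | rfl <;> rcases hy with rfl | rfl <;>
    simp [chi, CharTwo.add_self_eq_zero]

theorem sum_eq_zero_of_add_eq_neg {s : Finset F} {h : F → ℤ} {y : F} (hy : y ≠ 0)
    (hs : ∀ x ∈ s, x + y ∈ s) (hh : ∀ x ∈ s, h (x + y) = -h x) : ∑ x ∈ s, h x = 0 := by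
  refine Finset.sum_involution (fun x _ => x + y) (fun x hx => ?_) (fun x _ _ => ?_) hs
    (fun x _ => ?_)
  · rw [hh x hx, add_neg_cancel]
  · simpa using hy
  · rw [add_assoc, CharTwo.add_self_eq_zero, add_zero]

end CharTwo

theorem chi_zero (F : Type*) [Field F] : chi F 0 = 1 := if_pos rfl

theorem chi_one (F : Type*) [Field F] : chi F 1 = -1 := if_neg one_ne_zero

theorem chi_mul_self (F : Type*) [Field F] (x : F) : chi F x * chi F x = 1 := by
  unfold chi; split_ifs <;> rfl

theorem abs_chi (F : Type*) [Field F] (x : F) : |chi F x| = 1 := by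
  unfold chi; split_ifs <;> rfl

theorem degree_X_pow_add_of_degree_lt {R : Type*} [Semiring R] [Nontrivial R] {n : ℕ}
    {p : Polynomial R} (hp : p.degree < (n : WithBot ℕ)) :
    (Polynomial.X ^ n + p).degree = (n : WithBot ℕ) := by
  rw [Polynomial.degree_add_eq_left_of_degree_lt (by rwa [Polynomial.degree_X_pow]),
    Polynomial.degree_X_pow]

section QuadraticExtension

variable {F : Type*} [Field F] [Fintype F] {m : ℕ}

theorem card_filter_pow_add_self_le (hm : m ≠ 0) (t : F) :
    (Finset.univ.filter fun x : F => x ^ 2 ^ m + x = t).card ≤ 2 ^ m := by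
  have hq : 1 < 2 ^ m := Nat.one_lt_two_pow hm
  let p : Polynomial F := Polynomial.X ^ 2 ^ m + (Polynomial.X - Polynomial.C t)
  have hlt : (Polynomial.X - Polynomial.C t).degree < ((2 ^ m : ℕ) : WithBot ℕ) := by
    rw [Polynomial.degree_X_sub_C]; exact_mod_cast hq
  have hp : p.natDegree = 2 ^ m :=
    Polynomial.natDegree_eq_of_degree_eq_some (degree_X_pow_add_of_degree_lt hlt)
  have hp0 : p ≠ 0 := by
    intro h; rw [h, Polynomial.natDegree_zero] at hp; omega
  calc _ ≤ p.roots.toFinset.card := Finset.card_le_card fun x hx => by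
        rw [Multiset.mem_toFinset, Polynomial.mem_roots hp0, Polynomial.IsRoot.def]
        simp only [Finset.mem_filter, Finset.mem_univ, true_and] at hx
        simp only [p, Polynomial.eval_add, Polynomial.eval_sub, Polynomial.eval_pow,
          Polynomial.eval_X, Polynomial.eval_C]
        linear_combination hx
    _ ≤ p.roots.card := Multiset.toFinset_card_le _
    _ ≤ p.natDegree := p.card_roots'
    _ = 2 ^ m := hp

theorem pow_two_pow_pow (hF : Fintype.card F = (2 ^ m) ^ 2) (x : F) :
    (x ^ 2 ^ m) ^ 2 ^ m = x := by
  rw [← pow_mul, ← sq, ← hF, FiniteField.pow_card]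

theorem pow_two_pow_add_one_pow (hF : Fintype.card F = (2 ^ m) ^ 2) (x : F) :
    (x ^ (2 ^ m + 1)) ^ 2 ^ m = x ^ (2 ^ m + 1) := by
  rw [pow_succ, mul_pow, pow_two_pow_pow hF, mul_comm]

variable [CharP F 2]

theorem pow_add_self_pow (hF : Fintype.card F = (2 ^ m) ^ 2) (x : F) :
    (x ^ 2 ^ m + x) ^ 2 ^ m = x ^ 2 ^ m + x := by
  rw [add_pow_two_pow, pow_two_pow_pow hF, add_comm]

theorem filter_pow_eq_self :
    (Finset.univ.filter fun x : F => x ^ 2 ^ m = x) =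
      Finset.univ.filter fun x : F => x ^ 2 ^ m + x = 0 := by
  simp only [CharTwo.add_eq_zero]

theorem card_filter_pow_add_self (hm : m ≠ 0) (hF : Fintype.card F = (2 ^ m) ^ 2) {t : F}
    (ht : t ^ 2 ^ m = t) :
    (Finset.univ.filter fun x : F => x ^ 2 ^ m + x = t).card = 2 ^ m := by
  refine (card_filter_pow_add_self_le hm t).eq_of_not_lt fun hlt => ?_
  have hK : (Finset.univ.filter fun x : F => x ^ 2 ^ m = x).card ≤ 2 ^ m := by
    rw [filter_pow_eq_self]; exact card_filter_pow_add_self_le hm 0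
  have hsum := Finset.card_eq_sum_card_fiberwise (f := fun x : F => x ^ 2 ^ m + x)
    (s := Finset.univ) (t := Finset.univ.filter fun x : F => x ^ 2 ^ m = x)
    fun x _ => by simpa using pow_add_self_pow hF x
  have hlt' := Finset.sum_lt_sum (s := Finset.univ.filter fun x : F => x ^ 2 ^ m = x)
    (f := fun t => (Finset.univ.filter fun x : F => x ^ 2 ^ m + x = t).card)
    (g := fun _ => 2 ^ m) (fun t _ => card_filter_pow_add_self_le hm t)
    ⟨t, by simpa using ht, hlt⟩
  rw [← hsum, Finset.sum_const, smul_eq_mul, Finset.card_univ, hF] at hlt'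
  nlinarith

theorem card_filter_pow_eq_self (hm : m ≠ 0) (hF : Fintype.card F = (2 ^ m) ^ 2) :
    (Finset.univ.filter fun x : F => x ^ 2 ^ m = x).card = 2 ^ m := by
  rw [filter_pow_eq_self]
  exact card_filter_pow_add_self hm hF (zero_pow (by positivity))

theorem exists_FTr_eq_one (hm : m ≠ 0) (hF : Fintype.card F = (2 ^ m) ^ 2) :
    ∃ z : F, z ^ 2 ^ m = z ∧ FTr F m z = 1 := by
  by_contra! hcon
  obtain ⟨n, rfl⟩ := Nat.exists_eq_succ_of_ne_zero hm
  let p : Polynomial F := ∑ i ∈ Finset.range (n + 1), Polynomial.X ^ 2 ^ i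
  have hlt : (∑ i ∈ Finset.range n, (Polynomial.X : Polynomial F) ^ 2 ^ i).degree <
      ((2 ^ n : ℕ) : WithBot ℕ) := by
    refine (Polynomial.degree_sum_le _ _).trans_lt ?_
    rw [Finset.sup_lt_iff (WithBot.bot_lt_coe _)]
    intro i hi
    rw [Polynomial.degree_X_pow]
    exact_mod_cast Nat.pow_lt_pow_right one_lt_two (Finset.mem_range.mp hi)
  have hp : p.natDegree = 2 ^ n := by
    refine Polynomial.natDegree_eq_of_degree_eq_some ?_
    simp only [p, Finset.sum_range_succ]
    rw [add_comm]
    exact degree_X_pow_add_of_degree_lt hlt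
  have hp0 : p ≠ 0 := by
    intro h
    rw [h, Polynomial.natDegree_zero] at hp
    exact (Nat.two_pow_pos n).ne hp
  have hle : (Finset.univ.filter fun x : F => x ^ 2 ^ (n + 1) = x).card ≤ 2 ^ n :=
    calc _ ≤ p.roots.toFinset.card := Finset.card_le_card fun x hx => by
          rw [Multiset.mem_toFinset, Polynomial.mem_roots hp0, Polynomial.IsRoot.def]
          simp only [Finset.mem_filter, Finset.mem_univ, true_and] at hx
          have h0 := (FTr_eq_zero_or_one hx).resolve_right (hcon x hx)
          simpa [p, Polynomial.eval_finsetSum, FTr] using h0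
      _ ≤ p.roots.card := Multiset.toFinset_card_le _
      _ ≤ p.natDegree := p.card_roots'
      _ = 2 ^ n := hp
  rw [card_filter_pow_eq_self hm hF, pow_succ] at hle
  have := Nat.two_pow_pos n
  omega

theorem exists_FTr_mul_eq_one (hm : m ≠ 0) (hF : Fintype.card F = (2 ^ m) ^ 2) {a : F}
    (ha : a ≠ 0) (haq : a ^ 2 ^ m = a) :
    ∃ y : F, y ≠ 0 ∧ y ^ 2 ^ m = y ∧ FTr F m (a * y) = 1 := by
  obtain ⟨z, hz, hz1⟩ := exists_FTr_eq_one hm hF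
  refine ⟨z / a, ?_, by rw [div_pow, hz, haq], by rwa [mul_div_cancel₀ _ ha]⟩
  rintro h
  rcases div_eq_zero_iff.mp h with rfl | h
  · simp [FTr] at hz1
  · exact ha h

theorem sum_chi_FTr_mul (hm : m ≠ 0) (hF : Fintype.card F = (2 ^ m) ^ 2) {a : F}
    (haq : a ^ 2 ^ m = a) :
    ∑ y ∈ Finset.univ.filter (fun y : F => y ^ 2 ^ m = y), chi F (FTr F m (a * y)) =
      if a = 0 then 2 ^ m else 0 := by
  split_ifs with ha
  · subst ha
    have h0 : FTr F m 0 = 0 := by simp [FTr]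
    simp only [zero_mul, h0, chi_zero, Finset.sum_const, card_filter_pow_eq_self hm hF]
    simp
  · obtain ⟨y, hy0, hy, hy1⟩ := exists_FTr_mul_eq_one hm hF ha haq
    refine sum_eq_zero_of_add_eq_neg hy0 (fun x hx => ?_) fun x hx => ?_ <;>
      simp only [Finset.mem_filter, Finset.mem_univ, true_and] at hx ⊢
    · rw [add_pow_two_pow, hx, hy]
    · rw [mul_add, FTr_add, chi_add (FTr_eq_zero_or_one (by rw [mul_pow, haq, hx])) (Or.inr hy1),
        hy1, chi_one, mul_neg_one]

theorem sum_chi_FTr_mul_of_pow_add_self_eq (hm : m ≠ 0) (hF : Fintype.card F = (2 ^ m) ^ 2)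
    {t : F} (ht : t ^ 2 ^ m = t) (b : F) :
    ∑ x ∈ Finset.univ.filter (fun x : F => x ^ 2 ^ m + x = t), chi F (FTr F (2 * m) (b * x)) =
      if b ^ 2 ^ m = b then 2 ^ m * chi F (FTr F m (b * t)) else 0 := by
  split_ifs with hb
  · rw [Finset.sum_congr rfl (g := fun _ => chi F (FTr F m (b * t))), Finset.sum_const,
      card_filter_pow_add_self hm hF ht]
    · simp
    · intro x hx
      simp only [Finset.mem_filter, Finset.mem_univ, true_and] at hx
      rw [FTr_two_mul, mul_pow, hb, ← mul_add, hx]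
  · obtain ⟨y, hy0, hy, hy1⟩ := exists_FTr_mul_eq_one hm hF
      (fun h => hb (CharTwo.add_eq_zero.mp h)) (pow_add_self_pow hF b)
    refine sum_eq_zero_of_add_eq_neg hy0 (fun x hx => ?_) fun x hx => ?_ <;>
      simp only [Finset.mem_filter, Finset.mem_univ, true_and] at hx ⊢
    · rw [add_pow_two_pow, hy]
      linear_combination hx + CharTwo.add_self_eq_zero y
    · have hy2 : FTr F (2 * m) (b * y) = 1 := by
        rw [FTr_two_mul, mul_pow, hy, ← add_mul, hy1]
      have hx2 : FTr F (2 * m) (b * x) = 0 ∨ FTr F (2 * m) (b * x) = 1 := by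
        rw [FTr_two_mul]; exact FTr_eq_zero_or_one (pow_add_self_pow hF _)
      rw [mul_add, FTr_add, chi_add hx2 (Or.inr hy2), hy2, chi_one, mul_neg_one]

section Norm

variable {c ξ : F}

theorem sum_chi_FTr_norm (hm : m ≠ 0) (hF : Fintype.card F = (2 ^ m) ^ 2)
    (hcq : c ^ 2 ^ m = c) (hξq : ξ ^ 2 ^ m = ξ) (hcξ : c * ξ ^ 2 = 1) :
    ∑ x : F, chi F (FTr F m (c * x ^ (2 ^ m + 1))) = -2 ^ m := by
  have hξ : ξ ≠ 0 := by rintro rfl; simp at hcξ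
  have hc : c ≠ 0 := by rintro rfl; simp at hcξ
  have hNq (x : F) : (c * x ^ (2 ^ m + 1)) ^ 2 ^ m = c * x ^ (2 ^ m + 1) := by
    rw [mul_pow, hcq, pow_two_pow_add_one_pow hF]
  set K := Finset.univ.filter fun y : F => y ^ 2 ^ m = y with hK
  have hcoef (x : F) : (ξ⁻¹ + c * (x ^ 2 ^ m + x)) ^ 2 ^ m = ξ⁻¹ + c * (x ^ 2 ^ m + x) := by
    rw [add_pow_two_pow, inv_pow, hξq, mul_pow, hcq, pow_add_self_pow hF]
  have hshift (x y : F) (hy : y ∈ K) : chi F (FTr F m (c * (x + y) ^ (2 ^ m + 1))) =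
      chi F (FTr F m (c * x ^ (2 ^ m + 1))) *
        chi F (FTr F m ((ξ⁻¹ + c * (x ^ 2 ^ m + x)) * y)) := by
    simp only [hK, Finset.mem_filter, Finset.mem_univ, true_and] at hy
    have hsq : FTr F m (ξ⁻¹ * y) = FTr F m (c * y ^ 2) := by
      rw [← FTr_sq_eq (x := ξ⁻¹ * y) (by rw [mul_pow, inv_pow, hξq, hy])]
      congr 1
      field_simp
      linear_combination -y ^ 2 * hcξ
    have hexp : c * (x + y) ^ (2 ^ m + 1) =
        c * x ^ (2 ^ m + 1) + (c * y ^ 2 + c * (x ^ 2 ^ m + x) * y) := by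
      rw [pow_succ, add_pow_two_pow, hy, pow_succ]; ring
    rw [← chi_add (FTr_eq_zero_or_one (hNq x))
      (FTr_eq_zero_or_one (by rw [mul_pow, hcoef, hy])), hexp, FTr_add, FTr_add, add_mul,
      FTr_add, hsq]
  have hzero (x : F) : ξ⁻¹ + c * (x ^ 2 ^ m + x) = 0 ↔ x ^ 2 ^ m + x = ξ := by
    have hinv : ξ⁻¹ = c * ξ := by
      field_simp
      linear_combination -hcξ
    rw [CharTwo.add_eq_zero, hinv, mul_right_inj' hc, eq_comm]
  have hmain : (2 ^ m : ℤ) * ∑ x : F, chi F (FTr F m (c * x ^ (2 ^ m + 1))) =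
      2 ^ m * -2 ^ m := by
    calc _ = ∑ y ∈ K, ∑ x : F, chi F (FTr F m (c * (x + y) ^ (2 ^ m + 1))) := by
          have h (y : F) := Fintype.sum_equiv (Equiv.addRight y)
            (fun x => chi F (FTr F m (c * (x + y) ^ (2 ^ m + 1))))
            (fun x => chi F (FTr F m (c * x ^ (2 ^ m + 1)))) fun _ => rfl
          simp only [h, Finset.sum_const, hK, card_filter_pow_eq_self hm hF]
          simp
      _ = ∑ x : F, ∑ y ∈ K, chi F (FTr F m (c * (x + y) ^ (2 ^ m + 1))) := Finset.sum_comm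
      _ = ∑ x : F, if x ^ 2 ^ m + x = ξ then -2 ^ m else 0 := by
          refine Finset.sum_congr rfl fun x _ => ?_
          rw [Finset.sum_congr rfl (hshift x), ← Finset.mul_sum, hK,
            sum_chi_FTr_mul hm hF (hcoef x)]
          simp only [hzero]
          split_ifs with hx
          · rw [FTr_norm_eq_one hξq hcξ hx, chi_one, neg_one_mul]
          · rw [mul_zero]
      _ = 2 ^ m * -2 ^ m := by
          rw [← Finset.sum_filter, Finset.sum_const, card_filter_pow_add_self hm hF hξq]
          simp
  exact mul_left_cancel₀ (by positivity) hmain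

theorem sum_chi_FTr_norm_add (hm : m ≠ 0) (hF : Fintype.card F = (2 ^ m) ^ 2)
    (hcq : c ^ 2 ^ m = c) (hξq : ξ ^ 2 ^ m = ξ) (hcξ : c * ξ ^ 2 = 1) (b : F) :
    ∑ x : F, chi F (FTr F m (c * x ^ (2 ^ m + 1)) + FTr F (2 * m) (b * x)) =
      -2 ^ m * chi F (FTr F m (ξ ^ 2 * b ^ (2 ^ m + 1))) := by
  have hc : c ≠ 0 := by rintro rfl; simp at hcξ
  set d := ξ ^ 2 * b ^ 2 ^ m with hd
  have hdq : d ^ 2 ^ m = ξ ^ 2 * b := by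
    rw [hd, mul_pow, pow_two_pow_pow hF, pow_right_comm, hξq]
  have hNd : FTr F m (ξ ^ 2 * b ^ (2 ^ m + 1)) = 0 ∨ FTr F m (ξ ^ 2 * b ^ (2 ^ m + 1)) = 1 :=
    FTr_eq_zero_or_one (by rw [mul_pow, pow_right_comm, hξq, pow_two_pow_add_one_pow hF])
  have hexp (x : F) : c * (x + d) ^ (2 ^ m + 1) =
      c * x ^ (2 ^ m + 1) + ((b * x) ^ 2 ^ m + b * x) + ξ ^ 2 * b ^ (2 ^ m + 1) := by
    rw [pow_succ, add_pow_two_pow, hdq, pow_succ, pow_succ b, mul_pow, hd]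
    linear_combination (b * x + x ^ 2 ^ m * b ^ 2 ^ m + ξ ^ 2 * b * b ^ 2 ^ m) * hcξ
  have hterm (x : F) : chi F (FTr F m (c * x ^ (2 ^ m + 1)) + FTr F (2 * m) (b * x)) =
      chi F (FTr F m (c * (x + d) ^ (2 ^ m + 1))) *
        chi F (FTr F m (ξ ^ 2 * b ^ (2 ^ m + 1))) := by
    have hbit := FTr_eq_zero_or_one (k := m)
      (x := c * x ^ (2 ^ m + 1) + ((b * x) ^ 2 ^ m + b * x))
      (by rw [add_pow_two_pow, mul_pow c, hcq, pow_two_pow_add_one_pow hF, pow_add_self_pow hF])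
    rw [hexp, FTr_add _ (_ + _) (ξ ^ 2 * _), chi_add hbit hNd, mul_assoc, chi_mul_self, mul_one,
      FTr_add, FTr_two_mul]
  simp only [hterm]
  rw [← Finset.sum_mul, ← sum_chi_FTr_norm hm hF hcq hξq hcξ]
  congr 1
  exact Fintype.sum_equiv (Equiv.addRight d) _ _ fun _ => rfl

end Norm

end QuadraticExtension

/-- f(x) = 0 if x^q + x = c^{2^{m-1}-1} and f(x) = Tr_1^m(c x^{q+1}) otherwise, is bent. -/
theorem stmt_13 (m : ℕ) (hm : 2 ≤ m) (F : Type*) [Field F] [Fintype F]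
    (hF : Fintype.card F = (2 ^ m) ^ 2)
    (c : F) (hc : c ≠ 0) (hcq : c ^ (2 ^ m) = c)
    (f : F → F)
    (hf : ∀ x : F, f x = if x ^ (2 ^ m) + x = c ^ (2 ^ (m - 1) - 1) then 0
        else FTr F m (c * x ^ (2 ^ m + 1))) :
    ∀ b : F, |∑ x : F, chi F (f x + FTr F (2 * m) (b * x))| = (2 ^ m : ℤ) := by
  intro b
  have hm0 : m ≠ 0 := by omega
  have : CharP F 2 := charP_of_card_eq_prime_pow (f := m * 2) (by
    rw [← Nat.card_eq_fintype_card] at hF; rw [pow_mul]; simpa using hF)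
  set ξ := c ^ (2 ^ (m - 1) - 1) with hξ
  have hξq : ξ ^ 2 ^ m = ξ := by rw [hξ, pow_right_comm, hcq]
  have hcξ : c * ξ ^ 2 = 1 := by
    have h2 : 2 ^ m = 2 * 2 ^ (m - 1) := by rw [← pow_succ', Nat.sub_add_cancel (by omega)]
    have hpos := Nat.two_pow_pos (m - 1)
    refine mul_left_cancel₀ hc ?_
    rw [hξ, ← pow_mul, ← pow_succ', ← pow_succ', mul_one]
    convert hcq using 2
    omega
  have hterm (x : F) : chi F (f x + FTr F (2 * m) (b * x)) =
      chi F (FTr F m (c * x ^ (2 ^ m + 1)) + FTr F (2 * m) (b * x)) +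
        if x ^ 2 ^ m + x = ξ then 2 * chi F (FTr F (2 * m) (b * x)) else 0 := by
    rw [hf]
    split_ifs with hx
    · have hbit : FTr F (2 * m) (b * x) = 0 ∨ FTr F (2 * m) (b * x) = 1 := by
        rw [FTr_two_mul]; exact FTr_eq_zero_or_one (pow_add_self_pow hF _)
      rw [FTr_norm_eq_one hξq hcξ hx, chi_add (Or.inr rfl) hbit, zero_add, chi_one]
      ring
    · rw [add_zero]
  simp only [hterm]
  rw [Finset.sum_add_distrib, ← Finset.sum_filter, ← Finset.mul_sum,
    sum_chi_FTr_norm_add hm0 hF hcq hξq hcξ, sum_chi_FTr_mul_of_pow_add_self_eq hm0 hF hξq]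
  split_ifs with hb
  · have hN : FTr F m (ξ ^ 2 * b ^ (2 ^ m + 1)) = FTr F m (b * ξ) := by
      rw [pow_succ b, hb, ← FTr_sq_eq (x := b * ξ) (by rw [mul_pow, hb, hξq])]
      congr 1
      ring
    rw [hN, show -2 ^ m * chi F (FTr F m (b * ξ)) + 2 * (2 ^ m * chi F (FTr F m (b * ξ))) =
      2 ^ m * chi F (FTr F m (b * ξ)) by ring, abs_mul, abs_chi, mul_one, abs_of_pos]
    positivity
  · rw [mul_zero, add_zero, abs_mul, abs_chi, mul_one, abs_neg, abs_of_pos]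
    positivity
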